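/- Let r > 1 be real, 0 < L < H ≤ r·L, and p ∈ (0,1). Define w(L) = (L − pH)/(1 − p). Then p·H + (1 − p)·max(w(L), 0) ≥ (r/(2r − 1)) · ( p·H + (1 − p)·L ). -/

import Mathlib

/-- For a binary valued buyer with high value `H` (probability `p`) and low value `L`
(probability `1 - p`), with `0 < L < H ≤ r·L` and `r > 1`, the virtual valuation at the
low value is `w(L) = (L − p·H)/(1 − p)`, and
`p·H + (1 − p)·max(w(L), 0) ≥ (r/(2r − 1)) · (p·H + (1 − p)·L)`. -/
theorem stmt_1 (r L H p : ℝ) (hr : 1 < r) (hL : 0 < L) (hLH : L < H) (hHr : H ≤ r * L)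
    (hp0 : 0 < p) (hp1 : p < 1) :
    p * H + (1 - p) * max ((L - p * H) / (1 - p)) 0 ≥
      (r / (2 * r - 1)) * (p * H + (1 - p) * L) := by
  have h1p : 0 < 1 - p := sub_pos.mpr hp1
  have hH : 0 < H := hL.trans hLH
  have hr' : 0 < 2 * r - 1 := by linarith
  have hlhs : p * H + (1 - p) * max ((L - p * H) / (1 - p)) 0 = max L (p * H) := by
    rw [mul_max_of_nonneg _ _ h1p.le, mul_div_cancel₀ _ h1p.ne', mul_zero,
      ← max_add_add_left, add_sub_cancel, add_zero]
  rw [hlhs, ge_iff_le, div_mul_eq_mul_div, div_le_iff₀ hr']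
  rcases le_total (p * H) L with h | h
  · rw [max_eq_left h]
    refine le_of_mul_le_mul_right ?_ hH
    have h1 : 0 ≤ (L - p * H) * (r * (H - L)) :=
      mul_nonneg (sub_nonneg.mpr h) (mul_nonneg (by linarith) (by linarith))
    have h2 : 0 ≤ L * (r * L - H) := mul_nonneg hL.le (sub_nonneg.mpr hHr)
    linarith
  · rw [max_eq_right h]
    refine le_of_mul_le_mul_right ?_ hH
    have h1 : 0 ≤ (p * H - L) * ((r - 1) * H + r * L) :=
      mul_nonneg (sub_nonneg.mpr h)
        (add_nonneg (mul_nonneg (by linarith) hH.le) (mul_nonneg (by linarith) hL.le))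
    have h2 : 0 ≤ L * (r * L - H) := mul_nonneg hL.le (sub_nonneg.mpr hHr)
    linarith
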